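/- Let G be a finite multigraph, t ≥ 1 an integer, and K a field of characteristic 0. The algebras B_G^{F_t} and C_G^{F_t} are isomorphic as K-algebras. -/

import Mathlib

open MvPolynomial

namespace ForestAlg

variable {V E : Type*}

/-- Two vertices are directly connected by an edge of `A`. -/
def edgeRel (ends : E → Sym2 V) (A : Finset E) (v w : V) : Prop :=
  ∃ e ∈ A, ends e = s(v, w)

/-- Number of connected components of the spanning subgraph `(V, A)`. -/
noncomputable def numComponents (ends : E → Sym2 V) (A : Finset E) : ℕ :=
  Nat.card (Quot (edgeRel ends A))

/-- Rank `r(A) = v(G) - c(V,A)`. -/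
noncomputable def rank (ends : E → Sym2 V) (A : Finset E) : ℕ :=
  Nat.card V - numComponents ends A

/-- `A` is a subforest (contains no cycle): `|A| = v(G) - c(V,A)`. -/
def IsForest (ends : E → Sym2 V) (A : Finset E) : Prop :=
  A.card + numComponents ends A = Nat.card V

/-- The Tutte polynomial, evaluated at `(x, y)`. -/
noncomputable def tutte [Fintype E] {R : Type*} [CommRing R]
    (ends : E → Sym2 V) (x y : R) : R :=
  ∑ A ∈ (Finset.univ : Finset E).powerset,
    (x - 1) ^ (rank ends Finset.univ - rank ends A) *
      (y - 1) ^ (A.card - rank ends A)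

/-- `e ∉ F` is externally active for the subforest `F` with respect to the linear
order `o`: `F + e` contains a cycle and `e` is the minimal edge of that cycle
(the edges of the unique cycle of `F + e` are those whose removal does not
decrease the rank). -/
def ExtActive [DecidableEq E] (o : LinearOrder E) (ends : E → Sym2 V)
    (F : Finset E) (e : E) : Prop :=
  e ∉ F ∧ ¬ IsForest ends (insert e F) ∧
    ∀ f ∈ insert e F,
      rank ends ((insert e F).erase f) = rank ends (insert e F) → o.le e f

/-- External activity `act_G(F)`. -/
noncomputable def act [DecidableEq E] (o : LinearOrder E) (ends : E → Sym2 V)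
    (F : Finset E) : ℕ :=
  Set.ncard {e : E | ExtActive o ends F e}

/-- `D_I`: number of edges with one endpoint in `I` and the other outside `I`. -/
noncomputable def crossCount {n : ℕ} (ends : E → Sym2 (Fin n))
    (I : Finset (Fin n)) : ℕ :=
  Set.ncard {e : E | (∃ v ∈ ends e, v ∈ I) ∧ ∃ w ∈ ends e, w ∉ I}

/-- The ideal `J_G^{F_t}` generated by `(∑_{i ∈ I} x_i)^{t·D_I + 1}` over nonempty `I`. -/
noncomputable def forestIdeal (K : Type*) [Field K] {n : ℕ} (t : ℕ)
    (ends : E → Sym2 (Fin n)) : Ideal (MvPolynomial (Fin n) K) :=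
  Ideal.span {p | ∃ I : Finset (Fin n), I.Nonempty ∧
    p = (∑ i ∈ I, X i) ^ (t * crossCount ends I + 1)}

/-- The `k`-th graded component of `K[x_1,…,x_n]/J` (for homogeneous `J`):
the image of the degree-`k` homogeneous part in the quotient. -/
noncomputable def gradedPiece (K : Type*) [Field K] {n : ℕ}
    (J : Ideal (MvPolynomial (Fin n) K)) (k : ℕ) :
    Submodule K (MvPolynomial (Fin n) K ⧸ J) :=
  Submodule.map (Ideal.Quotient.mkₐ K J).toLinearMap
    (homogeneousSubmodule (Fin n) K k)

/-- Dimension of the `k`-th graded component of the quotient. -/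
noncomputable def gradedDim (K : Type*) [Field K] {n : ℕ}
    (J : Ideal (MvPolynomial (Fin n) K)) (k : ℕ) : ℕ :=
  Module.finrank K (gradedPiece K J k)

/-- The ideal `(φ_e^{t+1} : e ∈ E)` in `K[φ_e : e ∈ E]`. -/
noncomputable def phiIdeal (K : Type*) [Field K] (E : Type*) (t : ℕ) :
    Ideal (MvPolynomial E K) :=
  Ideal.span (Set.range fun e : E => (X e : MvPolynomial E K) ^ (t + 1))

/-- The algebra `Φ_G^{F_t}` generated by commuting variables `φ_e` with relations
`φ_e^{t+1} = 0`. -/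
abbrev Phi (K : Type*) [Field K] (E : Type*) (t : ℕ) : Type _ :=
  MvPolynomial E K ⧸ phiIdeal K E t

/-- The generator `φ_e` of `Φ_G^{F_t}`. -/
noncomputable def phiVar (K : Type*) [Field K] {E : Type*} (t : ℕ) (e : E) :
    Phi K E t :=
  Ideal.Quotient.mk (phiIdeal K E t) (X e)

/-- The smaller endpoint of an edge. -/
def symInf {n : ℕ} (s : Sym2 (Fin n)) : Fin n :=
  Sym2.lift ⟨fun a b => a ⊓ b, fun a b => inf_comm a b⟩ s

/-- The larger endpoint of an edge. -/
def symSup {n : ℕ} (s : Sym2 (Fin n)) : Fin n :=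
  Sym2.lift ⟨fun a b => a ⊔ b, fun a b => sup_comm a b⟩ s

/-- The coefficient `c_{i,e}`: `+1` if `i` is the smaller endpoint of the
non-loop edge `e`, `-1` if `i` is the larger endpoint, `0` otherwise. -/
def endCoeff {n : ℕ} (ends : E → Sym2 (Fin n)) (i : Fin n) (e : E) : ℤ :=
  (if i = symInf (ends e) then 1 else 0) - (if i = symSup (ends e) then 1 else 0)

/-- The element `X_i = ∑_e c_{i,e} φ_e` of `Φ_G^{F_t}`. -/
noncomputable def Xgen (K : Type*) [Field K] [Fintype E] {n : ℕ} (t : ℕ)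
    (ends : E → Sym2 (Fin n)) (i : Fin n) : Phi K E t :=
  ∑ e : E, endCoeff ends i e • phiVar K t e

/-- The subalgebra `C_G^{F_t}` of `Φ_G^{F_t}` generated by `X_1, …, X_n`. -/
noncomputable def Csub (K : Type*) [Field K] [Fintype E] {n : ℕ} (t : ℕ)
    (ends : E → Sym2 (Fin n)) : Subalgebra K (Phi K E t) :=
  Algebra.adjoin K (Set.range (Xgen K t ends))


open Finset

section Vanishing

variable {K : Type*} [CommRing K] {σ τ ι : Type*}

/-- `f` is annihilated by the constant coefficient after applying any product of a sublist of the
given list of derivations. -/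
def VanishesAlong :
    List (Derivation K (MvPolynomial σ K) (MvPolynomial σ K)) → MvPolynomial σ K → Prop
  | [], f => constantCoeff f = 0
  | D :: L, f => VanishesAlong L f ∧ VanishesAlong L (D f)

theorem VanishesAlong.sub {L : List (Derivation K (MvPolynomial σ K) (MvPolynomial σ K))}
    {f g : MvPolynomial σ K} (hf : VanishesAlong L f) (hg : VanishesAlong L g) :
    VanishesAlong L (f - g) := by
  induction L generalizing f g with
  | nil => simp_all [VanishesAlong]
  | cons D L ih => exact ⟨ih hf.1 hg.1, by rw [map_sub]; exact ih hf.2 hg.2⟩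

theorem vanishesAlong_map_iff (φ : MvPolynomial σ K →ₐ[K] MvPolynomial τ K)
    (hφ : ∀ f, constantCoeff (φ f) = constantCoeff f)
    (D : ι → Derivation K (MvPolynomial τ K) (MvPolynomial τ K))
    (D' : ι → Derivation K (MvPolynomial σ K) (MvPolynomial σ K))
    (hD : ∀ d f, D d (φ f) = φ (D' d f)) (L : List ι) (f : MvPolynomial σ K) :
    VanishesAlong (L.map D) (φ f) ↔ VanishesAlong (L.map D') f := by
  induction L generalizing f with
  | nil => simp [VanishesAlong, hφ]
  | cons d L ih => simp only [List.map_cons, VanishesAlong, hD, ih]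

/-- A chain rule: two derivations intertwined by an algebra map on the variables are intertwined. -/
theorem derivation_intertwine (φ : MvPolynomial σ K →ₐ[K] MvPolynomial τ K)
    (D : Derivation K (MvPolynomial τ K) (MvPolynomial τ K))
    (D' : Derivation K (MvPolynomial σ K) (MvPolynomial σ K))
    (h : ∀ i, D (φ (X i)) = φ (D' (X i))) (f : MvPolynomial σ K) :
    D (φ f) = φ (D' f) := by
  induction f using MvPolynomial.induction_on with
  | C a => simp [← algebraMap_eq]
  | add p q hp hq => simp [hp, hq]
  | mul_X p i hp => simp [Derivation.leibniz, hp, h]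

theorem constantCoeff_algHom (φ : MvPolynomial σ K →ₐ[K] MvPolynomial τ K)
    (h : ∀ i, constantCoeff (φ (X i)) = 0) (f : MvPolynomial σ K) :
    constantCoeff (φ f) = constantCoeff f := by
  induction f using MvPolynomial.induction_on with
  | C a => simp [← algebraMap_eq]
  | add p q hp hq => simp [hp, hq]
  | mul_X p i hp => simp [h]

theorem derivation_mul_pow_mem (D : Derivation K (MvPolynomial σ K) (MvPolynomial σ K))
    (J : Ideal (MvPolynomial σ K)) (q x : MvPolynomial σ K) (k : ℕ) (hk : x ^ k ∈ J) :
    D (q * x ^ (k + 1)) ∈ J := by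
  have h : D (q * x ^ (k + 1)) = (q * ((k + 1 : ℕ) * D x) + x * D q) * x ^ k := by
    rw [Derivation.leibniz, Derivation.leibniz_pow]
    simp only [smul_eq_mul, nsmul_eq_mul, Nat.add_sub_cancel]
    ring
  rw [h]
  exact J.mul_mem_left _ hk

theorem vanishesAlong_pderiv_of_mem [DecidableEq σ] (L : List σ) {f : MvPolynomial σ K}
    (hf : f ∈ Ideal.span (Set.range fun e : σ => (X e : MvPolynomial σ K) ^ (L.count e + 1))) :
    VanishesAlong (L.map (fun e => pderiv (R := K) e)) f := by
  induction L generalizing f with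
  | nil =>
    change f ∈ RingHom.ker (constantCoeff (R := K) (σ := σ))
    refine Ideal.span_le.2 ?_ hf
    rintro _ ⟨e, rfl⟩
    simp [RingHom.mem_ker]
  | cons d L ih =>
    refine ⟨ih (Ideal.span_le.2 ?_ hf), ih ?_⟩
    · rintro _ ⟨e, rfl⟩
      exact Ideal.pow_mem_of_pow_mem _ (Ideal.subset_span ⟨e, rfl⟩) (by
        rw [List.count_cons]; omega)
    · induction hf using Submodule.closure_induction with
      | zero => simp
      | add x y _ _ hx hy => rw [map_add]; exact Ideal.add_mem _ hx hy
      | smul_mem q x hx =>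
        obtain ⟨e, rfl⟩ := hx
        by_cases h : d = e
        · subst h
          simp only [List.count_cons_self, smul_eq_mul]
          exact derivation_mul_pow_mem _ _ _ _ _ (Ideal.subset_span ⟨d, rfl⟩)
        · have h' : pderiv d (X e : MvPolynomial σ K) = 0 := pderiv_X_of_ne (Ne.symm h)
          simp only [List.count_cons_of_ne h, smul_eq_mul]
          rw [Derivation.leibniz, Derivation.leibniz_pow, h']
          simp only [smul_eq_mul, mul_zero, smul_zero, zero_add]
          exact Ideal.mul_mem_right _ _ (Ideal.subset_span ⟨e, rfl⟩)

end Vanishing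

section Integration

variable {K : Type*} [Field K] {V : Type*}

/-- The derivation `∂_i - ∂_j` attached to an oriented edge `(i, j)`. -/
noncomputable def edgeDeriv (K : Type*) [Field K] [DecidableEq V] (d : V × V) :
    Derivation K (MvPolynomial V K) (MvPolynomial V K) :=
  pderiv d.1 - pderiv d.2

theorem edgeDeriv_X [DecidableEq V] (d : V × V) (v : V) :
    edgeDeriv K d (X v) = C ((if v = d.1 then 1 else 0) - (if v = d.2 then 1 else 0)) := by
  simp only [edgeDeriv, Derivation.sub_apply, pderiv_X, Pi.single_apply]
  split_ifs <;> simp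

theorem edgeDeriv_sum_X [DecidableEq V] (d : V × V) (I : Finset V) :
    edgeDeriv K d (∑ i ∈ I, X i)
      = C ((if d.1 ∈ I then 1 else 0) - (if d.2 ∈ I then 1 else 0)) := by
  rw [map_sum, Finset.sum_congr rfl fun v _ => edgeDeriv_X d v, ← map_sum,
    Finset.sum_sub_distrib, Finset.sum_ite_eq', Finset.sum_ite_eq']

theorem exists_iterate_eq_zero (D : Derivation K (MvPolynomial V K) (MvPolynomial V K))
    (hD : ∀ v, ∃ c : K, D (X v) = C c) (f : MvPolynomial V K) : ∃ k, D^[k] f = 0 := by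
  have hzero : ∀ k, D^[k] 0 = 0 := fun k => Function.iterate_fixed (map_zero D) k
  have hadd : ∀ k p q, D^[k] (p + q) = D^[k] p + D^[k] q := fun k p q => iterate_map_add D k p q
  have hC : ∀ k (c : K) p, D^[k] (C c * p) = C c * D^[k] p := by
    intro k c p
    induction k generalizing p with
    | zero => rfl
    | succ k ih =>
      rw [Function.iterate_succ_apply, Function.iterate_succ_apply, ← ih, ← smul_eq_C_mul,
        ← smul_eq_C_mul, Derivation.map_smul]
  have hX : ∀ v k p, D^[k] p = 0 → D^[k + 1] (p * X v) = 0 := by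
    intro v k
    obtain ⟨c, hc⟩ := hD v
    induction k with
    | zero =>
      intro p hp
      have hp : p = 0 := hp
      simp [hp]
    | succ k ih =>
      intro p hp
      rw [Function.iterate_succ_apply, Derivation.leibniz, hc, hadd, smul_eq_mul, smul_eq_mul,
        mul_comm p, hC, hp, mul_comm (X v), ih (D p) hp]
      simp
  induction f using MvPolynomial.induction_on with
  | C a => exact ⟨1, by simp [← algebraMap_eq]⟩
  | add p q hp hq =>
    obtain ⟨k, hk⟩ := hp
    obtain ⟨l, hl⟩ := hq
    refine ⟨k + l, ?_⟩
    rw [hadd, add_comm k l, Function.iterate_add_apply, hk, hzero, add_comm l k,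
      Function.iterate_add_apply, hl, hzero, add_zero]
  | mul_X p v hp =>
    obtain ⟨k, hk⟩ := hp
    exact ⟨k + 1, hX v k p hk⟩

/-- Integration by parts. -/
theorem exists_antideriv_mul_pow [CharZero K]
    (D : Derivation K (MvPolynomial V K) (MvPolynomial V K))
    (hD : ∀ v, ∃ c : K, D (X v) = C c) (x : MvPolynomial V K) (c : K) (hc : c ≠ 0)
    (hx : D x = C c) (q : MvPolynomial V K) (m : ℕ) :
    ∃ r, D (r * x ^ (m + 1)) = q * x ^ m := by
  obtain ⟨k, hk⟩ := exists_iterate_eq_zero D hD q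
  induction k generalizing q m with
  | zero =>
    have hk : q = 0 := hk
    exact ⟨0, by simp [hk]⟩
  | succ k ih =>
    have ha : c * ((m : K) + 1) ≠ 0 := mul_ne_zero hc (Nat.cast_add_one_ne_zero m)
    set a : K := (c * ((m : K) + 1))⁻¹ with hadef
    obtain ⟨r, hr⟩ := ih (D q) (m + 1) hk
    refine ⟨C a * q - C a * r * x, ?_⟩
    have h1 : (C a * q - C a * r * x) * x ^ (m + 1)
        = a • (q * x ^ (m + 1)) - a • (r * x ^ (m + 1 + 1)) := by
      simp only [smul_eq_C_mul]; ring
    have h2 : (C a * (C c * ((m : MvPolynomial V K) + 1)) : MvPolynomial V K) = 1 := by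
      rw [← map_natCast (C : K →+* MvPolynomial V K) m, ← C_1, ← C_add, ← C_mul, ← C_mul,
        hadef, inv_mul_cancel₀ ha]
    rw [h1, map_sub, Derivation.map_smul, Derivation.map_smul, hr, Derivation.leibniz,
      Derivation.leibniz_pow, hx]
    simp only [smul_eq_C_mul, smul_eq_mul, nsmul_eq_mul, Nat.add_sub_cancel, Nat.cast_add,
      Nat.cast_one]
    linear_combination (q * x ^ m) * h2

theorem eq_zero_of_nsmul_eq_mul [CharZero K]
    (D : Derivation K (MvPolynomial V K) (MvPolynomial V K))
    (x : MvPolynomial V K) (hx : D x = -1) (n c : ℕ) (h : MvPolynomial V K)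
    (hn : D^[n] h = 0) (hc : ((c : MvPolynomial V K) + 1) * h = x * D h) : h = 0 := by
  induction n generalizing c h with
  | zero => exact hn
  | succ n ih =>
    have h0 : D h = 0 := by
      refine ih (c + 1) (D h) hn ?_
      have h1 := congrArg D hc
      rw [Derivation.leibniz, Derivation.leibniz, hx, map_add, Derivation.map_natCast,
        Derivation.map_one_eq_zero] at h1
      simp only [smul_eq_mul] at h1
      push_cast
      linear_combination h1
    rw [h0, mul_zero] at hc
    exact (mul_eq_zero.1 hc).resolve_left (Nat.cast_add_one_ne_zero c)

end Integration

section Contraction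

variable {K : Type*} [Field K] {V : Type*} [Fintype V] [DecidableEq V]

/-- The pullback of polynomials along a map of vertices: `x_v ↦ ∑_{π u = v} x_u`. -/
noncomputable def fiberSum (K : Type*) [Field K] (π : V → V) :
    MvPolynomial V K →ₐ[K] MvPolynomial V K :=
  aeval fun v => ∑ u with π u = v, X u

theorem fiberSum_sum_X (π : V → V) (I : Finset V) :
    fiberSum K π (∑ i ∈ I, X i) = ∑ i with π i ∈ I, X i := by
  simp only [fiberSum, map_sum, aeval_X]
  rw [← Finset.sum_fiberwise_of_maps_to (s := {i | π i ∈ I}) (t := I) (g := π) (by simp)]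
  refine Finset.sum_congr rfl fun v hv => Finset.sum_congr ?_ fun _ _ => rfl
  ext u
  simp only [mem_filter, mem_univ, true_and]
  exact ⟨fun h => ⟨h ▸ hv, h⟩, fun h => h.2⟩

theorem edgeDeriv_fiberSum (π : V → V) (d : V × V) (f : MvPolynomial V K) :
    edgeDeriv K d (fiberSum K π f) = fiberSum K π (edgeDeriv K (Prod.map π π d) f) := by
  refine derivation_intertwine _ _ _ (fun v => ?_) f
  rw [edgeDeriv_X, fiberSum, aeval_X, edgeDeriv_sum_X, aeval_C, algebraMap_eq]
  simp only [mem_filter, mem_univ, true_and, Prod.map_fst, Prod.map_snd, eq_comm]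

theorem constantCoeff_fiberSum (π : V → V) (f : MvPolynomial V K) :
    constantCoeff (fiberSum K π f) = constantCoeff f :=
  constantCoeff_algHom _ (fun v => by simp [fiberSum, map_sum]) f

/-- The map identifying `j` with `i`. -/
def mergeMap (i j : V) (v : V) : V := if v = j then i else v

theorem fiberSum_mergeMap_eq [CharZero K] {i j : V} (hij : i ≠ j) {f : MvPolynomial V K}
    (hf : edgeDeriv K (i, j) f = 0) : fiberSum K (mergeMap i j) f = f := by
  have hdvd : (X j : MvPolynomial V K) ∣ fiberSum K (mergeMap i j) f - f := by
    rw [← Ideal.mem_span_singleton, ← Ideal.Quotient.mk_eq_mk_iff_sub_mem]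
    have : (Ideal.Quotient.mkₐ K (Ideal.span {(X j : MvPolynomial V K)})).comp
        (fiberSum K (mergeMap i j)) = Ideal.Quotient.mkₐ K _ := by
      refine MvPolynomial.algHom_ext fun v => ?_
      rw [AlgHom.comp_apply, Ideal.Quotient.mkₐ_eq_mk, Ideal.Quotient.mk_eq_mk_iff_sub_mem,
        Ideal.mem_span_singleton, fiberSum, aeval_X]
      by_cases hvj : v = j
      · subst hvj
        rw [Finset.filter_false_of_mem]
        · simp
        · intro u _
          simp only [mergeMap]
          split_ifs with h
          · exact hij
          · exact h
      · by_cases hvi : v = i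
        · subst hvi
          have : ({u | mergeMap v j u = v} : Finset V) = {v, j} := by
            ext u
            simp only [mem_filter, mem_univ, true_and, mem_insert, mem_singleton]
            unfold mergeMap
            split_ifs with h <;> simp [h]
          rw [this, Finset.sum_pair hij]
          simp
        · have : ({u | mergeMap i j u = v} : Finset V) = {v} := by
            ext u
            simp only [mem_filter, mem_univ, true_and, mem_singleton]
            unfold mergeMap
            split_ifs with h
            · subst h
              exact ⟨fun h' => absurd h'.symm hvi, fun h' => absurd h'.symm hvj⟩
            · rfl
          rw [this, Finset.sum_singleton]
          simp
    exact DFunLike.congr_fun this f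
  obtain ⟨g, hg⟩ := hdvd
  have hX : edgeDeriv K (i, j) (X j) = -1 := by simp [edgeDeriv_X, hij.symm]
  have h0 : edgeDeriv K (i, j) (X j * g) = 0 := by
    rw [← hg, map_sub, hf, edgeDeriv_fiberSum]
    simp [mergeMap, edgeDeriv]
  rw [Derivation.leibniz, hX, smul_eq_mul, smul_eq_mul] at h0
  obtain ⟨n, hn⟩ := exists_iterate_eq_zero (edgeDeriv K (i, j))
    (fun v => ⟨_, edgeDeriv_X _ v⟩) g
  have hg0 : g = 0 := eq_zero_of_nsmul_eq_mul _ _ hX n 0 g hn (by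
    push_cast; linear_combination -h0)
  rw [hg0, mul_zero] at hg
  exact sub_eq_zero.1 hg

end Contraction

section CutIdeal

variable {K : Type*} [Field K] {V : Type*} [DecidableEq V]

/-- An oriented edge has exactly one endpoint in `I`. -/
def Crosses (I : Finset V) (d : V × V) : Prop := ¬(d.1 ∈ I ↔ d.2 ∈ I)

instance (I : Finset V) : DecidablePred (Crosses I) := fun d =>
  inferInstanceAs (Decidable ¬(d.1 ∈ I ↔ d.2 ∈ I))

/-- The ideal generated by the powers of `∑_{i ∈ I} x_i` with exponent one more than the number of
edges of the list crossing `I`. -/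
noncomputable def cutIdeal (K : Type*) [Field K] (L : List (V × V)) :
    Ideal (MvPolynomial V K) :=
  Ideal.span (Set.range fun I : Finset V =>
    (∑ i ∈ I, X i : MvPolynomial V K) ^ (L.countP (Crosses I) + 1))

theorem pow_mem_cutIdeal (L : List (V × V)) (I : Finset V) :
    (∑ i ∈ I, X i : MvPolynomial V K) ^ (L.countP (Crosses I) + 1) ∈ cutIdeal K L :=
  Ideal.subset_span ⟨I, rfl⟩

theorem cutIdeal_cons_le (d : V × V) (L : List (V × V)) :
    cutIdeal K (d :: L) ≤ cutIdeal K L := by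
  refine Ideal.span_le.2 ?_
  rintro _ ⟨I, rfl⟩
  exact Ideal.pow_mem_of_pow_mem _ (pow_mem_cutIdeal L I) (by rw [List.countP_cons]; omega)

theorem edgeDeriv_sum_X_of_not_crosses {d : V × V} {I : Finset V}
    (h : ¬Crosses I d) : edgeDeriv K d (∑ i ∈ I, X i) = 0 := by
  rw [edgeDeriv_sum_X]
  simp only [Crosses, not_not] at h
  simp [h]

theorem edgeDeriv_mem_cutIdeal (d : V × V) (L : List (V × V))
    {f : MvPolynomial V K} (hf : f ∈ cutIdeal K (d :: L)) :
    edgeDeriv K d f ∈ cutIdeal K L := by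
  induction hf using Submodule.closure_induction with
  | zero => simp
  | add x y _ _ hx hy => rw [map_add]; exact Ideal.add_mem _ hx hy
  | smul_mem q x hx =>
    obtain ⟨I, rfl⟩ := hx
    by_cases h : Crosses I d
    · simp only [List.countP_cons, h, decide_true, if_true, smul_eq_mul]
      exact derivation_mul_pow_mem _ _ _ _ _ (pow_mem_cutIdeal L I)
    · simp only [List.countP_cons, h, decide_false, smul_eq_mul]
      rw [Derivation.leibniz, Derivation.leibniz_pow, edgeDeriv_sum_X_of_not_crosses h]
      simp only [smul_eq_mul, mul_zero, smul_zero, zero_add]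
      exact Ideal.mul_mem_right _ _ (pow_mem_cutIdeal L I)

theorem vanishesAlong_of_mem_cutIdeal (L : List (V × V)) {f : MvPolynomial V K}
    (hf : f ∈ cutIdeal K L) : VanishesAlong (L.map (edgeDeriv K)) f := by
  induction L generalizing f with
  | nil =>
    change f ∈ RingHom.ker (constantCoeff (R := K) (σ := V))
    refine Ideal.span_le.2 ?_ hf
    rintro _ ⟨I, rfl⟩
    simp [RingHom.mem_ker, map_sum]
  | cons d L ih => exact ⟨ih (cutIdeal_cons_le d L hf), ih (edgeDeriv_mem_cutIdeal d L hf)⟩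

theorem exists_antideriv_mem_cutIdeal [CharZero K] {d : V × V} (hd : d.1 ≠ d.2)
    (L : List (V × V)) {g : MvPolynomial V K} (hg : g ∈ cutIdeal K L) :
    ∃ h ∈ cutIdeal K (d :: L), edgeDeriv K d h = g := by
  have hconst : ∀ v, ∃ c : K, edgeDeriv K d (X v) = C c := fun v => ⟨_, edgeDeriv_X d v⟩
  induction hg using Submodule.closure_induction with
  | zero => exact ⟨0, by simp, by simp⟩
  | add x y _ _ hx hy =>
    obtain ⟨a, ha, rfl⟩ := hx
    obtain ⟨b, hb, rfl⟩ := hy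
    exact ⟨a + b, Ideal.add_mem _ ha hb, map_add _ _ _⟩
  | smul_mem q x hx =>
    obtain ⟨I, rfl⟩ := hx
    have hmem := pow_mem_cutIdeal (K := K) (d :: L) I
    by_cases h : Crosses I d
    · simp only [List.countP_cons, h, decide_true, if_true] at hmem
      obtain ⟨r, hr⟩ := exists_antideriv_mul_pow (edgeDeriv K d) hconst (∑ i ∈ I, X i) _
        (by simp only [Crosses] at h; split_ifs <;> simp_all) (edgeDeriv_sum_X d I) q
        (L.countP (Crosses I) + 1)
      exact ⟨_, Ideal.mul_mem_left _ r hmem, hr⟩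
    · simp only [List.countP_cons, h, decide_false] at hmem
      obtain ⟨r, hr⟩ := exists_antideriv_mul_pow (edgeDeriv K d) hconst (X d.1) 1 one_ne_zero
        (by simp [edgeDeriv_X, hd]) q 0
      refine ⟨_, Ideal.mul_mem_left _ (r * X d.1) hmem, ?_⟩
      rw [Derivation.leibniz, Derivation.leibniz_pow, edgeDeriv_sum_X_of_not_crosses h]
      simp only [zero_add, pow_one, pow_zero, mul_one] at hr
      simp [hr, mul_comm]

theorem fiberSum_mem_cutIdeal [Fintype V] {π : V → V} {d : V × V} (hd : π d.1 = π d.2)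
    (L : List (V × V)) {f : MvPolynomial V K}
    (hf : f ∈ cutIdeal K (L.map (Prod.map π π))) :
    fiberSum K π f ∈ cutIdeal K (d :: L) := by
  rw [← Ideal.mem_comap]
  refine Ideal.span_le.2 ?_ hf
  rintro _ ⟨I, rfl⟩
  rw [SetLike.mem_coe, Ideal.mem_comap, map_pow, fiberSum_sum_X]
  convert pow_mem_cutIdeal (K := K) (d :: L) {i | π i ∈ I} using 2
  rw [List.countP_map, List.countP_cons_of_neg (by simp [Crosses, hd])]
  congr 2
  ext x
  exact decide_eq_decide.2 (by simp [Crosses])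

theorem mem_cutIdeal_of_vanishesAlong [Fintype V] [CharZero K] (m : ℕ) (L : List (V × V))
    (hL : L.length = m) {f : MvPolynomial V K} (hf : VanishesAlong (L.map (edgeDeriv K)) f) :
    f ∈ cutIdeal K L := by
  induction m generalizing L f with
  | zero =>
    obtain rfl := List.length_eq_zero_iff.1 hL
    have hf : constantCoeff f = 0 := hf
    have key : ∀ p : MvPolynomial V K, p - C (constantCoeff p) ∈ cutIdeal K [] := by
      intro p
      rw [← Ideal.Quotient.mk_eq_mk_iff_sub_mem]
      induction p using MvPolynomial.induction_on with
      | C a => simp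
      | add p q hp hq => simp [hp, hq]
      | mul_X p i hp =>
        have hX : (X i : MvPolynomial V K) ∈ cutIdeal K [] := by
          simpa using pow_mem_cutIdeal (K := K) [] {i}
        simp [Ideal.Quotient.eq_zero_iff_mem.2 hX]
    simpa [hf] using key f
  | succ m ih =>
    obtain ⟨⟨i, j⟩, L, rfl⟩ := List.exists_cons_of_length_eq_add_one hL
    replace hL : L.length = m := by simpa using hL
    by_cases hij : i = j
    · subst hij
      have : cutIdeal K ((i, i) :: L) = cutIdeal K L := by
        simp [cutIdeal, Crosses]
      rw [this]
      exact ih L hL hf.1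
    · obtain ⟨h, hh, hfh⟩ := exists_antideriv_mem_cutIdeal (d := (i, j)) hij L (ih L hL hf.2)
      have hD : edgeDeriv K (i, j) (f - h) = 0 := by rw [map_sub, hfh, sub_self]
      have hN := hf.1.sub (vanishesAlong_of_mem_cutIdeal _ hh).1
      rw [← fiberSum_mergeMap_eq hij hD,
        vanishesAlong_map_iff _ (constantCoeff_fiberSum _) _ _ (edgeDeriv_fiberSum _)] at hN
      have hJ := ih (L.map (Prod.map (mergeMap i j) (mergeMap i j))) (by simpa using hL)
        (by rw [List.map_map]; exact hN)
      have := fiberSum_mem_cutIdeal (d := (i, j)) (by simp [mergeMap, hij]) L hJ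
      rw [fiberSum_mergeMap_eq hij hD] at this
      simpa using Ideal.add_mem _ this hh

end CutIdeal

section Kernel

variable {K : Type*} [Field K] {n : ℕ}

/-- The oriented edge from the smaller to the larger endpoint. -/
def orient (ends : E → Sym2 (Fin n)) (e : E) : Fin n × Fin n :=
  (symInf (ends e), symSup (ends e))

theorem crosses_orient_iff (ends : E → Sym2 (Fin n)) (I : Finset (Fin n)) (e : E) :
    Crosses I (orient ends e) ↔ (∃ v ∈ ends e, v ∈ I) ∧ ∃ w ∈ ends e, w ∉ I := by
  unfold orient Crosses
  induction ends e with
  | h a b =>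
    simp only [symInf, symSup, Sym2.lift_mk, Sym2.mem_iff, exists_eq_or_imp, exists_eq_left]
    rcases le_total a b with h | h <;> simp only [h, inf_of_le_left, inf_of_le_right,
      sup_of_le_left, sup_of_le_right] <;> tauto

variable [Fintype E]

theorem crossCount_eq (ends : E → Sym2 (Fin n)) (I : Finset (Fin n)) :
    crossCount ends I = #{e | Crosses I (orient ends e)} := by
  rw [crossCount, ← Set.ncard_coe_finset]
  congr 1
  ext e
  simp [crosses_orient_iff]

/-- The list of oriented edges, each repeated `t` times. -/
noncomputable def edgeList (E : Type*) [Fintype E] (t : ℕ) : List E :=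
  (t • (univ : Finset E).val).toList

theorem count_edgeList [DecidableEq E] (t : ℕ) (e : E) : (edgeList E t).count e = t := by
  rw [← Multiset.coe_count, edgeList, Multiset.coe_toList, Multiset.count_nsmul,
    Multiset.count_univ]
  simp

theorem countP_edgeList (ends : E → Sym2 (Fin n)) (t : ℕ) (I : Finset (Fin n)) :
    ((edgeList E t).map (orient ends)).countP (Crosses I) = t * crossCount ends I := by
  have h := Multiset.coe_countP (fun e => Crosses I (orient ends e)) (edgeList E t)
  rw [List.countP_map, crossCount_eq]
  refine h.symm.trans ?_
  rw [edgeList, Multiset.coe_toList, Multiset.countP_nsmul, Multiset.countP_eq_card_filter]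
  rfl

theorem forestIdeal_eq_cutIdeal (ends : E → Sym2 (Fin n)) (t : ℕ) :
    forestIdeal K t ends = cutIdeal K ((edgeList E t).map (orient ends)) := by
  apply le_antisymm
  · refine Ideal.span_le.2 ?_
    rintro _ ⟨I, -, rfl⟩
    rw [← countP_edgeList]
    exact pow_mem_cutIdeal _ I
  · refine Ideal.span_le.2 ?_
    rintro _ ⟨I, rfl⟩
    rcases I.eq_empty_or_nonempty with rfl | hI
    · simp
    · exact Ideal.subset_span ⟨I, hI, by simp only [countP_edgeList]⟩

/-- The lift of `X_i` to the polynomial ring in the variables `φ_e`. -/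
noncomputable def liftGen (K : Type*) [Field K] (ends : E → Sym2 (Fin n)) (i : Fin n) :
    MvPolynomial E K :=
  ∑ e : E, endCoeff ends i e • X e

theorem mk_aeval_liftGen (ends : E → Sym2 (Fin n)) (t : ℕ) (f : MvPolynomial (Fin n) K) :
    Ideal.Quotient.mk (phiIdeal K E t) (aeval (liftGen K ends) f)
      = aeval (Xgen K t ends) f := by
  have : (Ideal.Quotient.mkₐ K (phiIdeal K E t)).comp (aeval (liftGen K ends))
      = aeval (Xgen K t ends) := by
    refine MvPolynomial.algHom_ext fun i => ?_
    simp only [AlgHom.comp_apply, aeval_X, liftGen, Xgen, map_sum, map_zsmul]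
    rfl
  exact DFunLike.congr_fun this f

theorem vanishesAlong_of_aeval_eq_zero (ends : E → Sym2 (Fin n)) (t : ℕ)
    {f : MvPolynomial (Fin n) K} (hf : aeval (Xgen K t ends) f = 0) :
    VanishesAlong (((edgeList E t).map (orient ends)).map (edgeDeriv K)) f := by
  classical
  rw [← mk_aeval_liftGen, Ideal.Quotient.eq_zero_iff_mem] at hf
  have h := vanishesAlong_pderiv_of_mem (edgeList E t) (f := aeval (liftGen K ends) f)
    (by simpa only [count_edgeList, phiIdeal] using hf)
  rw [vanishesAlong_map_iff (aeval (liftGen K ends))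
    (constantCoeff_algHom _ fun i => by simp [liftGen, map_sum]) _
    (fun e => edgeDeriv K (orient ends e))] at h
  · rwa [List.map_map]
  · intro e
    refine derivation_intertwine _ _ _ fun i => ?_
    rw [edgeDeriv_X, aeval_X, aeval_C, liftGen, map_sum]
    simp only [map_zsmul, pderiv_X, Pi.single_apply]
    by_cases h₁ : i = symInf (ends e) <;> by_cases h₂ : i = symSup (ends e) <;>
      simp [endCoeff, orient, h₁, h₂]

theorem sum_pow_eq_zero {R ι : Type*} [CommRing R] (t : ℕ) (a : ι → R) (s : Finset ι)
    (h : ∀ i ∈ s, a i ^ (t + 1) = 0) : (∑ i ∈ s, a i) ^ (t * #s + 1) = 0 := by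
  classical
  induction s using Finset.induction_on with
  | empty => simp
  | insert i s hi ih =>
    rw [Finset.sum_insert hi, Finset.card_insert_of_notMem hi]
    refine (Commute.all _ _).add_pow_eq_zero_of_add_le_succ_of_pow_eq_zero (h i (by simp))
      (ih fun j hj => h j (by simp [hj])) ?_
    rw [mul_add]
    omega

theorem aeval_Xgen_sum_pow (ends : E → Sym2 (Fin n)) (t : ℕ) (I : Finset (Fin n)) :
    (∑ i ∈ I, Xgen K t ends i) ^ (t * crossCount ends I + 1) = 0 := by
  classical
  have h : ∑ i ∈ I, Xgen K t ends i
      = ∑ e with Crosses I (orient ends e), (∑ i ∈ I, endCoeff ends i e) • phiVar K t e := by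
    simp only [Xgen]
    rw [Finset.sum_comm, Finset.sum_filter]
    refine Finset.sum_congr rfl fun e _ => ?_
    rw [← Finset.sum_smul]
    split_ifs with hc
    · rfl
    · simp only [Crosses, orient, not_not] at hc
      simp [endCoeff, Finset.sum_sub_distrib, hc]
  rw [h, crossCount_eq]
  refine sum_pow_eq_zero t _ _ fun e _ => ?_
  have : phiVar K t e ^ (t + 1) = 0 := by
    rw [phiVar, ← map_pow, Ideal.Quotient.eq_zero_iff_mem]
    exact Ideal.subset_span ⟨e, rfl⟩
  rw [smul_pow, this, smul_zero]

theorem forestIdeal_eq_ker [CharZero K] (ends : E → Sym2 (Fin n)) (t : ℕ) :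
    forestIdeal K t ends = RingHom.ker (aeval (R := K) (Xgen K t ends)) := by
  apply le_antisymm
  · refine Ideal.span_le.2 ?_
    rintro _ ⟨I, -, rfl⟩
    rw [SetLike.mem_coe, RingHom.mem_ker, map_pow, map_sum]
    simpa only [aeval_X] using aeval_Xgen_sum_pow ends t I
  · intro f hf
    rw [forestIdeal_eq_cutIdeal]
    exact mem_cutIdeal_of_vanishesAlong _ _ rfl (vanishesAlong_of_aeval_eq_zero ends t hf)

end Kernel

/-- For a finite multigraph `G`, an integer `t ≥ 1` and a
field `K` of characteristic `0`, the algebras `B_G^{F_t}` and `C_G^{F_t}` are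
isomorphic as `K`-algebras. -/
theorem B_iso_C_Ft {n : ℕ} {E : Type} [Fintype E] (ends : E → Sym2 (Fin n))
    (t : ℕ) (ht : 1 ≤ t) (K : Type) [Field K] [CharZero K] :
    Nonempty ((MvPolynomial (Fin n) K ⧸ forestIdeal K t ends) ≃ₐ[K]
      Csub K t ends) := by
  rw [forestIdeal_eq_ker, Csub, Algebra.adjoin_range_eq_range_aeval]
  exact ⟨Ideal.quotientKerEquivRange (aeval (R := K) (Xgen K t ends))⟩

end ForestAlg
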